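/- Let T = A∘B be a closed operator on H with A ∈ L⁺(H) and B nonnegative selfadjoint (T ∈ L²₊), and suppose the iterated composition T^{2^n} is closed for every natural number n. Then there exists a sequence (Sₙ) of nonnegative selfadjoint operators on H such that S₀ = B, Sₙ = Sₙ₋₁∘A∘Sₙ₋₁ for every n ≥ 1, and T^{2^n} = A∘Sₙ for every n (so every closed power T^{2^n} again belongs to L²₊). -/

import Mathlib

open scoped ComplexOrder
noncomputable section

local notation "⟪" x ", " y "⟫" => @inner ℂ _ _ x y

section Toolkit

/-- Composition of partially defined linear maps:
`pcomp S T` has domain `{x ∈ dom T : T x ∈ dom S}` and maps `x ↦ S (T x)`. -/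
def pcomp {R E F G : Type*} [CommRing R] [AddCommGroup E] [Module R E]
    [AddCommGroup F] [Module R F] [AddCommGroup G] [Module R G]
    (S : F →ₗ.[R] G) (T : E →ₗ.[R] F) : E →ₗ.[R] G where
  domain := (S.domain.comap T.toFun).map T.domain.subtype
  toFun := (S.toFun.comp (T.toFun.restrict (p := S.domain.comap T.toFun) (q := S.domain)
      fun _ hx => hx)).comp
    (Submodule.equivMapOfInjective T.domain.subtype (Submodule.injective_subtype _)
      (S.domain.comap T.toFun)).symm.toLinearMap

/-- A bounded everywhere-defined operator viewed as a `LinearPMap` with domain `⊤`. -/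
def ofCLM {E F : Type*} [NormedAddCommGroup E] [NormedAddCommGroup F]
    [NormedSpace ℂ E] [NormedSpace ℂ F] (X : E →L[ℂ] F) : E →ₗ.[ℂ] F :=
  (X : E →ₗ[ℂ] F).toPMap ⊤

variable {H : Type*} [NormedAddCommGroup H] [InnerProductSpace ℂ H] [CompleteSpace H]

/-- `B` is nonnegative selfadjoint: densely defined, `B* = B`, and `⟪Bx, x⟫ ≥ 0` on `dom B`. -/
def IsNonnegSelfAdjoint (B : H →ₗ.[ℂ] H) : Prop :=
  Dense (B.domain : Set H) ∧ B.adjoint = B ∧ ∀ x : B.domain, 0 ≤ ⟪B x, (x : H)⟫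

/-- `C` is a selfadjoint partial operator: densely defined with `C* = C`. -/
def IsSelfAdjointPMap (C : H →ₗ.[ℂ] H) : Prop :=
  Dense (C.domain : Set H) ∧ C.adjoint = C

/-- A quasi-affinity: an injective bounded everywhere-defined operator with dense range. -/
def IsQuasiAffinity (G : H →L[ℂ] H) : Prop :=
  Function.Injective G ∧ DenseRange G

end Toolkit

/-- Powers of a partial operator: `ppow T n = T^(n+1)`, so `T^1 = T` and `T^(k+1) = T ∘ T^k`. -/
def ppow {R E : Type*} [CommRing R] [AddCommGroup E] [Module R E]
    (T : E →ₗ.[R] E) : ℕ → (E →ₗ.[R] E)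
  | 0 => T
  | n + 1 => pcomp T (ppow T n)

section

variable {R E F G K : Type*} [CommRing R] [AddCommGroup E] [Module R E] [AddCommGroup F]
  [Module R F] [AddCommGroup G] [Module R G] [AddCommGroup K] [Module R K]

theorem mem_graph_pcomp (S : F →ₗ.[R] G) (T : E →ₗ.[R] F) (x : E) (z : G) :
    (x, z) ∈ (pcomp S T).graph ↔ ∃ y, (x, y) ∈ T.graph ∧ (y, z) ∈ S.graph := by
  have key (a : T.domain) (ha : T a ∈ S.domain) (h : (a : E) ∈ (pcomp S T).domain) :
      pcomp S T ⟨a, h⟩ = S ⟨T a, ha⟩ := by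
    have : (Submodule.equivMapOfInjective T.domain.subtype (Submodule.injective_subtype _)
        (S.domain.comap T.toFun)).symm ⟨a, h⟩ = ⟨a, ha⟩ := by
      rw [LinearEquiv.symm_apply_eq]
      rfl
    exact congrArg (fun b : S.domain.comap T.toFun => S ⟨T b, b.2⟩) this
  simp only [LinearPMap.mem_graph_iff]
  constructor
  · rintro ⟨⟨x', a, ha, rfl⟩, rfl, rfl⟩
    exact ⟨T a, ⟨a, rfl, rfl⟩, ⟨T a, ha⟩, rfl, (key a ha _).symm⟩
  · rintro ⟨y, ⟨a, rfl, rfl⟩, ⟨b, hb⟩, rfl, rfl⟩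
    exact ⟨⟨a, a, hb, rfl⟩, rfl, key a hb _⟩

theorem pcomp_assoc (U : G →ₗ.[R] K) (S : F →ₗ.[R] G) (T : E →ₗ.[R] F) :
    pcomp (pcomp U S) T = pcomp U (pcomp S T) := by
  apply LinearPMap.eq_of_eq_graph
  ext ⟨x, z⟩
  simp only [mem_graph_pcomp]
  constructor
  · rintro ⟨y, hy, w, hw, hz⟩
    exact ⟨w, ⟨y, hy, hw⟩, hz⟩
  · rintro ⟨w, ⟨y, hy, hw⟩, hz⟩
    exact ⟨y, hy, w, hw, hz⟩

theorem ppow_add_add_one (T : E →ₗ.[R] E) (m n : ℕ) :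
    ppow T (m + n + 1) = pcomp (ppow T m) (ppow T n) := by
  induction m with
  | zero => rw [Nat.zero_add]; rfl
  | succ m ih =>
    rw [show m + 1 + n + 1 = (m + n + 1) + 1 by ring]
    simp only [ppow] at ih ⊢
    rw [ih, pcomp_assoc]

end

theorem mem_graph_ofCLM {E F : Type*} [NormedAddCommGroup E] [NormedAddCommGroup F]
    [NormedSpace ℂ E] [NormedSpace ℂ F] (X : E →L[ℂ] F) (x : E) (y : F) :
    (x, y) ∈ (ofCLM X).graph ↔ X x = y := by
  rw [LinearPMap.mem_graph_iff]
  constructor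
  · rintro ⟨a, rfl, rfl⟩
    rfl
  · rintro rfl
    exact ⟨⟨x, Submodule.mem_top⟩, rfl, rfl⟩

theorem mem_graph_ofCLM_pcomp {D E F : Type*} [AddCommGroup D] [Module ℂ D]
    [NormedAddCommGroup E] [NormedAddCommGroup F]
    [NormedSpace ℂ E] [NormedSpace ℂ F] (X : E →L[ℂ] F) (B : D →ₗ.[ℂ] E) (x : D) (y : F) :
    (x, y) ∈ (pcomp (ofCLM X) B).graph ↔ ∃ b : B.domain, (b : D) = x ∧ X (B b) = y := by
  rw [mem_graph_pcomp]
  simp only [mem_graph_ofCLM]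
  constructor
  · rintro ⟨y, hy, rfl⟩
    obtain ⟨b, hb, rfl⟩ := (LinearPMap.mem_graph_iff _).1 hy
    exact ⟨b, hb, rfl⟩
  · rintro ⟨b, rfl, rfl⟩
    exact ⟨B b, B.mem_graph b, rfl⟩

section

variable {H : Type*} [NormedAddCommGroup H] [InnerProductSpace ℂ H] [CompleteSpace H]

/-- A symmetric nonnegative operator `S` such that `1 + S` is onto is selfadjoint. -/
theorem isNonnegSelfAdjoint_of_surjective {S : H →ₗ.[ℂ] H} (hsymm : S.IsFormalAdjoint S)
    (hnonneg : ∀ x : S.domain, 0 ≤ ⟪S x, (x : H)⟫)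
    (hsurj : ∀ z : H, ∃ x : S.domain, (x : H) + S x = z) : IsNonnegSelfAdjoint S := by
  have hdense : Dense (S.domain : Set H) := by
    rw [Submodule.dense_iff_topologicalClosure_eq_top,
      Submodule.topologicalClosure_eq_top_iff, Submodule.eq_bot_iff]
    intro w hw
    obtain ⟨x, rfl⟩ := hsurj w
    have h := Submodule.inner_left_of_mem_orthogonal x.2 hw
    rw [inner_add_left] at h
    have h1 : (0 : ℂ) ≤ ⟪(x : H), (x : H)⟫ := by
      rw [← inner_self_ofReal_norm]
      exact RCLike.ofReal_nonneg.2 (norm_nonneg _)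
    have hx : x = 0 := by
      rw [← Submodule.coe_eq_zero, ← inner_self_eq_zero (𝕜 := ℂ)]
      exact ((add_eq_zero_iff_of_nonneg h1 (hnonneg x)).1 h).1
    simp [hx]
  have hle : S ≤ S.adjoint := hsymm.le_adjoint hdense
  refine ⟨hdense, (LinearPMap.eq_of_le_of_domain_eq hle (le_antisymm hle.1 ?_)).symm, hnonneg⟩
  intro y hy
  obtain ⟨x, hx⟩ := hsurj (y + S.adjoint ⟨y, hy⟩)
  suffices y - x = 0 by rw [sub_eq_zero.1 this]; exact x.2
  rw [← inner_self_eq_zero (𝕜 := ℂ)]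
  obtain ⟨u, hu⟩ := hsurj (y - x)
  nth_rewrite 2 [← hu]
  have h1 := LinearPMap.adjoint_isFormalAdjoint hdense ⟨y, hy⟩ u
  have h2 := hsymm x u
  have h3 := congrArg (fun v => ⟪v, (u : H)⟫) hx
  simp only [inner_add_left] at h3
  rw [inner_sub_left, inner_add_right, inner_add_right, ← h2, ← h1, h3, sub_self]

theorem isClosed_pcomp_of_adjoint_comp {R A : H →L[ℂ] H} (hR : A = R.adjoint ∘L R)
    {B : H →ₗ.[ℂ] H} (hT : (pcomp (ofCLM A) B).IsClosed) : (pcomp (ofCLM R) B).IsClosed := by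
  apply IsSeqClosed.isClosed
  rintro u ⟨x, y⟩ hu hlim
  have hu' (n) := (mem_graph_ofCLM_pcomp R B (u n).1 (u n).2).1 (hu n)
  have hmem : (x, R.adjoint y) ∈ (pcomp (ofCLM A) B).graph := by
    refine IsClosed.mem_of_tendsto hT (f := fun n => ((u n).1, R.adjoint (u n).2))
      (b := Filter.atTop) ?_ (Filter.Eventually.of_forall fun n => ?_)
    · exact ((continuous_fst.prodMk (R.adjoint.continuous.comp continuous_snd)).tendsto _).comp
        hlim
    · obtain ⟨b, hb, hy⟩ := hu' n
      exact (mem_graph_ofCLM_pcomp _ _ _ _).2 ⟨b, hb, by rw [hR, ← hy]; rfl⟩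
  obtain ⟨b, hb, hy⟩ := (mem_graph_ofCLM_pcomp _ _ _ _).1 hmem
  refine (mem_graph_ofCLM_pcomp _ _ _ _).2 ⟨b, hb, ?_⟩
  have hker : R.adjoint (R (B b) - y) = 0 := by
    rw [map_sub, ← hy, hR]
    exact sub_self _
  have horth (v : H) : ⟪R (B b) - y, R v⟫ = 0 := by
    rw [← ContinuousLinearMap.adjoint_inner_left, hker, inner_zero_left]
  have hlim' : ⟪R (B b) - y, y⟫ = 0 := by
    refine tendsto_nhds_unique (f := fun n => ⟪R (B b) - y, (u n).2⟫) (l := Filter.atTop)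
      (((continuous_const.inner continuous_snd).tendsto (x, y)).comp hlim) ?_
    refine tendsto_const_nhds.congr fun n => ?_
    obtain ⟨c, -, hc⟩ := hu' n
    rw [← hc, horth]
  rw [← sub_eq_zero, ← inner_self_eq_zero (𝕜 := ℂ)]
  rw [inner_sub_right, horth, hlim', sub_self]

/-- For closed `A ∘ B ∈ L²₊`, writing `A = R* ∘ R`, the operator `B ∘ A ∘ B` is the selfadjoint
operator `C* ∘ C` with `C = R ∘ B` closed. -/
theorem IsNonnegSelfAdjoint.pcomp_pcomp {A : H →L[ℂ] H} (hA : A.IsPositive)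
    {B : H →ₗ.[ℂ] H} (hB : IsNonnegSelfAdjoint B) (hT : (pcomp (ofCLM A) B).IsClosed) :
    IsNonnegSelfAdjoint (pcomp B (pcomp (ofCLM A) B)) := by
  obtain ⟨hdense, hadj, -⟩ := hB
  have hsymm : B.IsFormalAdjoint B := by
    have := LinearPMap.adjoint_isFormalAdjoint hdense
    rwa [hadj] at this
  obtain ⟨R, hR⟩ : ∃ R : H →L[ℂ] H, A = R.adjoint ∘L R :=
    CStarAlgebra.nonneg_iff_eq_star_mul_self.1
      ((ContinuousLinearMap.nonneg_iff_isPositive A).2 hA)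
  have hS (x : (pcomp B (pcomp (ofCLM A) B)).domain) : ∃ (b : B.domain) (c : B.domain),
      (b : H) = x ∧ (c : H) = A (B b) ∧ pcomp B (pcomp (ofCLM A) B) x = B c := by
    obtain ⟨y, hy, hz⟩ := (mem_graph_pcomp _ _ _ _).1
      (LinearPMap.mem_graph (pcomp B (pcomp (ofCLM A) B)) x)
    obtain ⟨b, hb, rfl⟩ := (mem_graph_ofCLM_pcomp _ _ _ _).1 hy
    obtain ⟨c, hc, hc'⟩ := (LinearPMap.mem_graph_iff _).1 hz
    exact ⟨b, c, hb, hc, hc'.symm⟩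
  refine isNonnegSelfAdjoint_of_surjective ?_ ?_ ?_
  · intro x y
    obtain ⟨b, c, hb, hc, h⟩ := hS x
    obtain ⟨b', c', hb', hc', h'⟩ := hS y
    rw [h, h', ← hb, ← hb', hsymm c b', ← hsymm b c', hc, hc']
    exact hA.isSymmetric _ _
  · intro x
    obtain ⟨b, c, hb, hc, h⟩ := hS x
    rw [h, ← hb, hsymm c b, hc]
    exact hA.inner_nonneg_left _
  · intro z
    set Γ : Submodule ℂ (WithLp 2 (H × H)) :=
      (pcomp (ofCLM R) B).graph.comap (WithLp.linearEquiv 2 ℂ (H × H)).toLinearMap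
    have hΓ : IsClosed (Γ : Set (WithLp 2 (H × H))) :=
      (isClosed_pcomp_of_adjoint_comp hR hT).preimage (WithLp.prod_continuous_ofLp _ _ _)
    have : CompleteSpace Γ := hΓ.completeSpace_coe
    obtain ⟨g, hg, hperp⟩ :=
      Submodule.HasOrthogonalProjection.exists_orthogonal (K := Γ) (WithLp.toLp 2 (z, 0))
    obtain ⟨b, hb, hb'⟩ := (mem_graph_ofCLM_pcomp R B g.fst g.snd).1 hg
    have hinner (u : B.domain) : ⟪z - b, (u : H)⟫ = ⟪A (B b), B u⟫ := by
      have hu : WithLp.toLp 2 ((u : H), R (B u)) ∈ Γ :=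
        (mem_graph_ofCLM_pcomp R B _ _).2 ⟨u, rfl, rfl⟩
      have h := Submodule.inner_left_of_mem_orthogonal hu hperp
      simp only [WithLp.prod_inner_apply, WithLp.ofLp_sub, Prod.fst_sub, Prod.snd_sub] at h
      change ⟪z - g.fst, (u : H)⟫ + ⟪0 - g.snd, R (B u)⟫ = 0 at h
      rw [← hb, ← hb', zero_sub, inner_neg_left, add_neg_eq_zero] at h
      rw [h, hR, ContinuousLinearMap.comp_apply, ContinuousLinearMap.adjoint_inner_left]
    have hmem : A (B b) ∈ B.adjoint.domain :=
      LinearPMap.mem_adjoint_domain_of_exists _ ⟨z - b, hinner⟩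
    have hgraph : (A (B b), z - (b : H)) ∈ B.adjoint.graph :=
      (LinearPMap.mem_graph_iff _).2
        ⟨⟨_, hmem⟩, rfl, LinearPMap.adjoint_apply_eq hdense _ hinner⟩
    rw [hadj] at hgraph
    obtain ⟨x, hx, hx'⟩ := (LinearPMap.mem_graph_iff _).1 <|
      (mem_graph_pcomp B (pcomp (ofCLM A) B) (b : H) (z - b)).2
        ⟨_, (mem_graph_ofCLM_pcomp A B _ _).2 ⟨b, rfl, rfl⟩, hgraph⟩
    exact ⟨x, by rw [hx, hx', add_sub_cancel]⟩

end

/-- If `T = A ∘ B ∈ L²₊` and every power `T^(2^n)` is closed, then there is a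
sequence `Sₙ` of nonnegative selfadjoint operators with `S₀ = B`, `Sₙ = Sₙ₋₁ ∘ A ∘ Sₙ₋₁` and
`T^(2^n) = A ∘ Sₙ` (note `T^k = ppow T (k-1)`). -/
theorem statement3
    {H : Type*} [NormedAddCommGroup H] [InnerProductSpace ℂ H] [CompleteSpace H]
    (A : H →L[ℂ] H) (hA : A.IsPositive)
    (B : H →ₗ.[ℂ] H) (hB : IsNonnegSelfAdjoint B)
    (hT : (pcomp (ofCLM A) B).IsClosed)
    (hpow : ∀ n : ℕ, (ppow (pcomp (ofCLM A) B) (2 ^ n - 1)).IsClosed) :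
    ∃ S : ℕ → (H →ₗ.[ℂ] H),
      (∀ n : ℕ, IsNonnegSelfAdjoint (S n)) ∧
      S 0 = B ∧
      (∀ n : ℕ, S (n + 1) = pcomp (S n) (pcomp (ofCLM A) (S n))) ∧
      (∀ n : ℕ, ppow (pcomp (ofCLM A) B) (2 ^ n - 1) = pcomp (ofCLM A) (S n)) := by
  let S : ℕ → (H →ₗ.[ℂ] H) := Nat.rec B fun _ S => pcomp S (pcomp (ofCLM A) S)
  have hS (n : ℕ) : ppow (pcomp (ofCLM A) B) (2 ^ n - 1) = pcomp (ofCLM A) (S n) := by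
    induction n with
    | zero => rfl
    | succ n ih =>
      have hn : 2 ^ (n + 1) - 1 = (2 ^ n - 1) + (2 ^ n - 1) + 1 := by
        have := Nat.one_le_two_pow (n := n)
        rw [pow_succ]
        omega
      rw [hn, ppow_add_add_one, ih, pcomp_assoc]
  refine ⟨S, fun n => ?_, rfl, fun _ => rfl, hS⟩
  induction n with
  | zero => exact hB
  | succ n ih => exact ih.pcomp_pcomp hA (hS n ▸ hpow n)
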